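/- arXiv:1405.7546 — 2 statements merged into one kernel-verified Lean document; each statement's English description precedes it below -/
import Mathlib

section
/- Let n ≥ 2 be even and let m ≥ n+3. The polynomial f^{(4)}_{m,n+1} = Σ_{σ ∈ S_{n+1}} sgn(σ) [x₂,x₁,x_{σ(1)},x₁,…,x₁][x_{σ(2)},x_{σ(3)}]⋯[x_{σ(n)},x_{σ(n+1)}], where the first left-normed commutator has m−n−3 occurrences of x₁ after x_{σ(1)} and the sum runs over all permutations σ of {1,…,n+1}, is not a polynomial identity of the relatively free algebra F_n(A). -/
noncomputable section

/-- `f ∈ K⟨X⟩` (with set of variables `X`) is a polynomial identity of the `K`-algebra `R`: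
every substitution of elements of `R` for the variables (i.e. every `K`-algebra homomorphism
from the free algebra to `R`) kills `f`. -/
def IsPI (K : Type) [Field K] {X : Type} (R : Type) [Ring R] [Algebra K R]
    (f : FreeAlgebra K X) : Prop :=
  ∀ φ : FreeAlgebra K X →ₐ[K] R, φ f = 0

/-- `T(R)`: the set of polynomial identities of `R` inside `K⟨x₁, x₂, …⟩`
(the free unital associative algebra on countably many variables, indexed by `ℕ`). -/
def TId (K : Type) [Field K] (R : Type) [Ring R] [Algebra K R] : Set (FreeAlgebra K ℕ) :=
  {f | IsPI K R f}

/-- A two-sided ideal of `K⟨X⟩` is a T-ideal when it is invariant under all algebra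
endomorphisms of `K⟨X⟩`. -/
def IsTIdeal (K : Type) [Field K] (I : TwoSidedIdeal (FreeAlgebra K ℕ)) : Prop :=
  ∀ φ : FreeAlgebra K ℕ →ₐ[K] FreeAlgebra K ℕ, ∀ f ∈ I, φ f ∈ I

/-- `⟨F⟩^T`: the smallest T-ideal of `K⟨X⟩` containing the set `F`. -/
def TIdealGen (K : Type) [Field K] (F : Set (FreeAlgebra K ℕ)) : Set (FreeAlgebra K ℕ) :=
  {g | ∀ I : TwoSidedIdeal (FreeAlgebra K ℕ), IsTIdeal K I → F ⊆ (I : Set (FreeAlgebra K ℕ)) → g ∈ I}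

/-- The commutator `[a, b] = a * b - b * a`. -/
def br {R : Type} [Ring R] (a b : R) : R := a * b - b * a

/-- The left-normed commutator `[a, b, b, …, b]` with `k` occurrences of `b`. -/
def commPow {R : Type} [Ring R] (a b : R) (k : ℕ) : R := (fun y => br y b)^[k] a

/-- The variable `xᵢ` of `K⟨x₁, x₂, …⟩` (1-based indexing). -/
def xv (K : Type) [Field K] (i : ℕ) : FreeAlgebra K ℕ := FreeAlgebra.ι K i

/-- The product of commutators `[x₁,x₂][x₃,x₄]⋯[x_{2k-1},x_{2k}]`. -/
def chainProd (K : Type) [Field K] (k : ℕ) : FreeAlgebra K ℕ :=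
  ((List.range k).map fun i => br (xv K (2 * i + 1)) (xv K (2 * i + 2))).prod

/-- The Grassmann (exterior) algebra of an infinite dimensional `K`-vector space
with basis `e₁, e₂, …`. -/
abbrev Einf (K : Type) [Field K] : Type := ExteriorAlgebra K (ℕ →₀ K)

/-- The Grassmann (exterior) algebra `E⁽ⁿ⁾` of an `n`-dimensional `K`-vector space. -/
abbrev Efin (K : Type) [Field K] (n : ℕ) : Type := ExteriorAlgebra K (Fin n → K)

/-- The even part `E₀` of the Grassmann algebra of `V`. -/
def evenPart (K V : Type) [Field K] [AddCommGroup V] [Module K V] :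
    Submodule K (ExteriorAlgebra K V) :=
  CliffordAlgebra.evenOdd (0 : QuadraticForm K V) 0

/-- The odd part `E₁` of the Grassmann algebra of `V`. -/
def oddPart (K V : Type) [Field K] [AddCommGroup V] [Module K V] :
    Submodule K (ExteriorAlgebra K V) :=
  CliffordAlgebra.evenOdd (0 : QuadraticForm K V) 1

section matrixAlgebras

variable (K V : Type) [Field K] [AddCommGroup V] [Module K V]

private theorem evenPart_mul_mem {a b : ExteriorAlgebra K V}
    (ha : a ∈ evenPart K V) (hb : b ∈ evenPart K V) : a * b ∈ evenPart K V := by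
  have := CliffordAlgebra.evenOdd_mul_le (Q := (0 : QuadraticForm K V)) 0 0
    (Submodule.mul_mem_mul ha hb)
  simpa [evenPart] using this

private theorem evenPart_one_mem : (1 : ExteriorAlgebra K V) ∈ evenPart K V :=
  SetLike.one_mem_graded _

private theorem evenPart_algebraMap_mem (c : K) :
    algebraMap K (ExteriorAlgebra K V) c ∈ evenPart K V :=
  SetLike.algebraMap_mem_graded _ c

/-- The algebra `A` (over the Grassmann algebra of `V`): the subalgebra of `2 × 2`
matrices over `E = Λ(V)` whose `(1,1)` entry lies in `E₀`, whose `(2,1)` entry is `0`,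
and whose `(1,2)` and `(2,2)` entries are arbitrary. -/
def algA : Subalgebra K (Matrix (Fin 2) (Fin 2) (ExteriorAlgebra K V)) where
  carrier := {M | M 0 0 ∈ evenPart K V ∧ M 1 0 = 0}
  mul_mem' := by
    rintro a b ⟨ha0, ha1⟩ ⟨hb0, hb1⟩
    refine ⟨?_, ?_⟩
    · have h : (a * b) 0 0 = a 0 0 * b 0 0 + a 0 1 * b 1 0 := by
        simp [Matrix.mul_apply, Fin.sum_univ_two]
      rw [h, hb1, mul_zero, add_zero]
      exact evenPart_mul_mem K V ha0 hb0
    · have h : (a * b) 1 0 = a 1 0 * b 0 0 + a 1 1 * b 1 0 := by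
        simp [Matrix.mul_apply, Fin.sum_univ_two]
      rw [h, ha1, hb1, zero_mul, mul_zero, add_zero]
  one_mem' := by
    refine ⟨?_, ?_⟩
    · rw [Matrix.one_apply_eq]; exact evenPart_one_mem K V
    · exact Matrix.one_apply_ne (by decide)
  add_mem' := by
    rintro a b ⟨ha0, ha1⟩ ⟨hb0, hb1⟩
    exact ⟨Submodule.add_mem _ ha0 hb0, by simp [ha1, hb1]⟩
  zero_mem' := ⟨Submodule.zero_mem _, rfl⟩
  algebraMap_mem' := fun c => by
    refine ⟨?_, ?_⟩
    · rw [Matrix.algebraMap_matrix_apply, if_pos rfl]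
      exact evenPart_algebraMap_mem K V c
    · rw [Matrix.algebraMap_matrix_apply, if_neg (by decide)]

end matrixAlgebras

section matrixAlgebras2

variable (K V : Type) [Field K] [AddCommGroup V] [Module K V]

private theorem oddPart_mul_mem_even {a b : ExteriorAlgebra K V}
    (ha : a ∈ oddPart K V) (hb : b ∈ oddPart K V) : a * b ∈ evenPart K V := by
  have := CliffordAlgebra.evenOdd_mul_le (Q := (0 : QuadraticForm K V)) 1 1
    (Submodule.mul_mem_mul ha hb)
  have h2 : ((1 : ZMod 2) + 1) = 0 := by decide
  rw [h2] at this
  exact this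

private theorem even_mul_odd_mem {a b : ExteriorAlgebra K V}
    (ha : a ∈ evenPart K V) (hb : b ∈ oddPart K V) : a * b ∈ oddPart K V := by
  have := CliffordAlgebra.evenOdd_mul_le (Q := (0 : QuadraticForm K V)) 0 1
    (Submodule.mul_mem_mul ha hb)
  rw [zero_add] at this
  exact this

private theorem odd_mul_even_mem {a b : ExteriorAlgebra K V}
    (ha : a ∈ oddPart K V) (hb : b ∈ evenPart K V) : a * b ∈ oddPart K V := by
  have := CliffordAlgebra.evenOdd_mul_le (Q := (0 : QuadraticForm K V)) 1 0
    (Submodule.mul_mem_mul ha hb)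
  rw [add_zero] at this
  exact this

/-- The algebra `A′` (over the Grassmann algebra of `V`): the subalgebra of `2 × 2`
matrices over `E = Λ(V)` whose `(2,2)` entry lies in `E₀`, whose `(2,1)` entry is `0`,
and whose `(1,1)` and `(1,2)` entries are arbitrary. -/
def algA' : Subalgebra K (Matrix (Fin 2) (Fin 2) (ExteriorAlgebra K V)) where
  carrier := {M | M 1 1 ∈ evenPart K V ∧ M 1 0 = 0}
  mul_mem' := by
    rintro a b ⟨ha0, ha1⟩ ⟨hb0, hb1⟩
    refine ⟨?_, ?_⟩
    · have h : (a * b) 1 1 = a 1 0 * b 0 1 + a 1 1 * b 1 1 := by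
        simp [Matrix.mul_apply, Fin.sum_univ_two]
      rw [h, ha1, zero_mul, zero_add]
      exact evenPart_mul_mem K V ha0 hb0
    · have h : (a * b) 1 0 = a 1 0 * b 0 0 + a 1 1 * b 1 0 := by
        simp [Matrix.mul_apply, Fin.sum_univ_two]
      rw [h, ha1, hb1, zero_mul, mul_zero, add_zero]
  one_mem' := by
    refine ⟨?_, ?_⟩
    · rw [Matrix.one_apply_eq]; exact evenPart_one_mem K V
    · exact Matrix.one_apply_ne (by decide)
  add_mem' := by
    rintro a b ⟨ha0, ha1⟩ ⟨hb0, hb1⟩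
    exact ⟨Submodule.add_mem _ ha0 hb0, by simp [ha1, hb1]⟩
  zero_mem' := ⟨Submodule.zero_mem _, rfl⟩
  algebraMap_mem' := fun c => by
    refine ⟨?_, ?_⟩
    · rw [Matrix.algebraMap_matrix_apply, if_pos rfl]
      exact evenPart_algebraMap_mem K V c
    · rw [Matrix.algebraMap_matrix_apply, if_neg (by decide)]

/-- The algebra `M_{1,1}` (over the Grassmann algebra of `V`): the subalgebra of `2 × 2`
matrices over `E = Λ(V)` whose diagonal entries lie in `E₀` and whose off-diagonal entries
lie in `E₁`. -/
def m11 : Subalgebra K (Matrix (Fin 2) (Fin 2) (ExteriorAlgebra K V)) where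
  carrier := {M | M 0 0 ∈ evenPart K V ∧ M 1 1 ∈ evenPart K V ∧
    M 0 1 ∈ oddPart K V ∧ M 1 0 ∈ oddPart K V}
  mul_mem' := by
    rintro a b ⟨ha00, ha11, ha01, ha10⟩ ⟨hb00, hb11, hb01, hb10⟩
    have h00 : (a * b) 0 0 = a 0 0 * b 0 0 + a 0 1 * b 1 0 := by
      simp [Matrix.mul_apply, Fin.sum_univ_two]
    have h11 : (a * b) 1 1 = a 1 0 * b 0 1 + a 1 1 * b 1 1 := by
      simp [Matrix.mul_apply, Fin.sum_univ_two]
    have h01 : (a * b) 0 1 = a 0 0 * b 0 1 + a 0 1 * b 1 1 := by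
      simp [Matrix.mul_apply, Fin.sum_univ_two]
    have h10 : (a * b) 1 0 = a 1 0 * b 0 0 + a 1 1 * b 1 0 := by
      simp [Matrix.mul_apply, Fin.sum_univ_two]
    refine ⟨?_, ?_, ?_, ?_⟩
    · rw [h00]
      exact Submodule.add_mem _ (evenPart_mul_mem K V ha00 hb00)
        (oddPart_mul_mem_even K V ha01 hb10)
    · rw [h11]
      exact Submodule.add_mem _ (oddPart_mul_mem_even K V ha10 hb01)
        (evenPart_mul_mem K V ha11 hb11)
    · rw [h01]
      exact Submodule.add_mem _ (even_mul_odd_mem K V ha00 hb01)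
        (odd_mul_even_mem K V ha01 hb11)
    · rw [h10]
      exact Submodule.add_mem _ (odd_mul_even_mem K V ha10 hb00)
        (even_mul_odd_mem K V ha11 hb10)
  one_mem' := by
    refine ⟨?_, ?_, ?_, ?_⟩
    · rw [Matrix.one_apply_eq]; exact evenPart_one_mem K V
    · rw [Matrix.one_apply_eq]; exact evenPart_one_mem K V
    · rw [Matrix.one_apply_ne (by decide)]; exact Submodule.zero_mem _
    · rw [Matrix.one_apply_ne (by decide)]; exact Submodule.zero_mem _
  add_mem' := by
    rintro a b ⟨ha00, ha11, ha01, ha10⟩ ⟨hb00, hb11, hb01, hb10⟩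
    exact ⟨Submodule.add_mem _ ha00 hb00, Submodule.add_mem _ ha11 hb11,
      Submodule.add_mem _ ha01 hb01, Submodule.add_mem _ ha10 hb10⟩
  zero_mem' := ⟨Submodule.zero_mem _, Submodule.zero_mem _,
    Submodule.zero_mem _, Submodule.zero_mem _⟩
  algebraMap_mem' := fun c => by
    refine ⟨?_, ?_, ?_, ?_⟩
    · rw [Matrix.algebraMap_matrix_apply, if_pos rfl]
      exact evenPart_algebraMap_mem K V c
    · rw [Matrix.algebraMap_matrix_apply, if_pos rfl]
      exact evenPart_algebraMap_mem K V c
    · rw [Matrix.algebraMap_matrix_apply, if_neg (by decide)]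
      exact Submodule.zero_mem _
    · rw [Matrix.algebraMap_matrix_apply, if_neg (by decide)]
      exact Submodule.zero_mem _

end matrixAlgebras2

/-- The relatively free algebra `F_n(R) = K⟨x₁, …, xₙ⟩ / (K⟨x₁, …, xₙ⟩ ∩ T(R))` of rank `n`
of the variety generated by `R`: the quotient of the free algebra on `n` variables by the
ideal of polynomial identities of `R` in those variables. -/
abbrev RelFree (K : Type) [Field K] (R : Type) [Ring R] [Algebra K R] (n : ℕ) : Type :=
  RingQuot (fun f g : FreeAlgebra K (Fin n) => IsPI K R (f - g))

end

/-- The exterior product of finitely many distinct standard basis vectors is nonzero. -/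
theorem ιMulti_single_ne_zero (K : Type) [Field K] (N : ℕ) :
    ExteriorAlgebra.ιMulti K N
      (fun i : Fin N => (Finsupp.single (i : ℕ) (1 : K) : ℕ →₀ K)) ≠ 0 := by
  intro h
  let restrict : (ℕ →₀ K) →ₗ[K] (Fin N → K) :=
    (LinearMap.funLeft K K (fun i : Fin N => (i : ℕ))).comp Finsupp.lcoeFun
  let vol : (ℕ →₀ K) [⋀^Fin N]→ₗ[K] K := Matrix.detRowAlternating.compLinearMap restrict
  have h1 := ExteriorAlgebra.liftAlternating_apply_ιMulti
    (Function.update (0 : ∀ i, (ℕ →₀ K) [⋀^Fin i]→ₗ[K] K) N vol)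
    (fun i : Fin N => (Finsupp.single (i : ℕ) (1 : K) : ℕ →₀ K))
  rw [h, map_zero, Function.update_self] at h1
  have h2 : (fun i : Fin N => restrict (Finsupp.single (i : ℕ) (1 : K))) =
      (1 : Matrix (Fin N) (Fin N) K) := by
    ext i j
    simp [restrict, LinearMap.funLeft_apply, Finsupp.single_apply, Matrix.one_apply, Fin.ext_iff]
  have h3 : Matrix.det (fun i : Fin N => restrict (Finsupp.single (i : ℕ) (1 : K))) = 0 := h1.symm
  rw [h2, Matrix.det_one] at h3
  exact one_ne_zero h3

theorem br_scalar_add_ι {K V : Type} [Field K] [AddCommGroup V] [Module K V] (s t : K) (v w : V) :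
    br (algebraMap K _ s + ExteriorAlgebra.ι K v) (algebraMap K _ t + ExteriorAlgebra.ι K w) =
      (2 : K) • (ExteriorAlgebra.ι K v * ExteriorAlgebra.ι K w) := by
  have h1 := ExteriorAlgebra.ι_add_mul_swap (R := K) v w
  have h2 := Algebra.commutes (R := K) s (ExteriorAlgebra.ι K w)
  have h3 := Algebra.commutes (R := K) t (ExteriorAlgebra.ι K v)
  have h4 := Algebra.commutes (R := K) s (algebraMap K (ExteriorAlgebra K V) t)
  have h5 := eq_neg_of_add_eq_zero_right h1
  simp only [br, mul_add, add_mul, h2, h3, h4, h5, two_smul]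
  abel

theorem prod_ofFn_pairs {M : Type} [Monoid M] (g : ℕ → M) (c N : ℕ) (h : N = 2 * c) :
    (List.ofFn fun i : Fin c => g (2 * i) * g (2 * i + 1)).prod =
      (List.ofFn fun i : Fin N => g i).prod := by
  subst h
  induction c with
  | zero => simp
  | succ c ih =>
    rw [List.ofFn_succ_last, List.prod_append]
    simp only [Fin.val_castSucc, ih]
    rw [show 2 * (c + 1) = 2 * c + 1 + 1 by ring, List.ofFn_succ_last, List.prod_append,
      List.ofFn_succ_last, List.prod_append]
    simp [mul_assoc]

theorem prod_ofFn_smul {K R : Type} [Field K] [Ring R] [Algebra K R] (t : K) (c : ℕ)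
    (g : Fin c → R) : (List.ofFn fun i => t • g i).prod = t ^ c • (List.ofFn g).prod := by
  induction c with
  | zero => simp
  | succ c ih => simp [List.ofFn_succ, ih, smul_smul, pow_succ]

theorem map_br {R S F : Type} [Ring R] [Ring S] [FunLike F R S] [RingHomClass F R S]
    (φ : F) (a b : R) : φ (br a b) = br (φ a) (φ b) := by
  simp [br]

theorem map_commPow {R S F : Type} [Ring R] [Ring S] [FunLike F R S] [RingHomClass F R S]
    (φ : F) (a b : R) (k : ℕ) : φ (commPow a b k) = commPow (φ a) (φ b) k := by
  induction k with
  | zero => rfl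
  | succ k ih =>
    simp only [commPow, Function.iterate_succ_apply'] at ih ⊢
    rw [map_br, ih]

theorem commPow_succ {R : Type} [Ring R] (a b : R) (k : ℕ) :
    commPow a b (k + 1) = br (commPow a b k) b :=
  Function.iterate_succ_apply' _ _ _

/-- If `f` is an identity of the relatively free algebra of rank `n` of `R`, then it vanishes on
every family of elements of `R` obtained by evaluating polynomials at `n` elements of `R`. -/
theorem IsPI.eval_words_eq_zero {K : Type} [Field K] {R : Type} [Ring R] [Algebra K R] {n : ℕ}
    {f : FreeAlgebra K ℕ} (hf : IsPI K (RelFree K R n) f) (w : ℕ → FreeAlgebra K (Fin n))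
    (a : Fin n → R) :
    FreeAlgebra.lift K (fun i => FreeAlgebra.lift K a (w i)) f = 0 := by
  let s : FreeAlgebra K (Fin n) → FreeAlgebra K (Fin n) → Prop := fun f g => IsPI K R (f - g)
  let ev : RingQuot s →ₐ[K] R := RingQuot.liftAlgHom K ⟨FreeAlgebra.lift K a, fun x y h => by
    have := h (FreeAlgebra.lift K a)
    rwa [map_sub, sub_eq_zero] at this⟩
  let φ : FreeAlgebra K ℕ →ₐ[K] RingQuot s :=
    FreeAlgebra.lift K fun i => RingQuot.mkAlgHom K s (w i)
  have key : FreeAlgebra.lift K (fun i => FreeAlgebra.lift K a (w i)) = ev.comp φ := by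
    ext i
    simp [ev, φ, RingQuot.liftAlgHom_mkAlgHom_apply]
  rw [key, AlgHom.comp_apply, hf φ, map_zero]

section upperTriangular

variable {R : Type} [Ring R]

theorem br_upper (p q r p' q' r' : R) :
    br !![p, q; 0, r] !![p', q'; 0, r'] =
      !![br p p', p * q' + q * r' - (p' * q + q' * r); 0, br r r'] := by
  ext i j
  fin_cases i <;> fin_cases j <;> simp [br]

theorem prod_ofFn_upper (c : ℕ) (p q r : Fin c → R) :
    ∃ p' q' : R, (List.ofFn fun i => !![p i, q i; 0, r i]).prod =
      !![p', q'; 0, (List.ofFn r).prod] := by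
  induction c with
  | zero => exact ⟨1, 0, by ext i j; fin_cases i <;> fin_cases j <;> simp⟩
  | succ c ih =>
    obtain ⟨p', q', h⟩ := ih (fun i => p i.succ) (fun i => q i.succ) (fun i => r i.succ)
    refine ⟨p 0 * p', p 0 * q' + q 0 * (List.ofFn fun i => r i.succ).prod, ?_⟩
    rw [List.ofFn_succ, List.prod_cons, h, List.ofFn_succ, List.prod_cons]
    ext i j
    fin_cases i <;> fin_cases j <;> simp

theorem commPow_upper_zero (q r q' r' : R) (k : ℕ) :
    ∃ q'' r'' : R, commPow !![0, q; 0, r] !![0, q'; 0, r'] k = !![0, q''; 0, r''] := by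
  induction k with
  | zero => exact ⟨q, r, rfl⟩
  | succ k ih =>
    obtain ⟨q'', r'', h⟩ := ih
    rw [commPow_succ, h, br_upper]
    exact ⟨_, _, by simp [br]; exact ⟨rfl, rfl⟩⟩

theorem commPow_strictUpper (q r : R) (k : ℕ) :
    commPow !![0, q; 0, 0] !![0, 0; 0, r] k = !![0, q * r ^ k; 0, 0] := by
  induction k with
  | zero => simp [commPow]
  | succ k ih => rw [commPow_succ, ih, br_upper]; simp [br, pow_succ, mul_assoc]

end upperTriangular

/-- The `(2,2)` entries of the matrices `genMat`: those of index `< n` have linearly independent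
odd parts, and the one of index `0` has constant term `1`. -/
noncomputable def diagEntry (K : Type) [Field K] (n i : ℕ) : Einf K :=
  if i < n then algebraMap K _ (if i = 0 then 1 else 0) + ExteriorAlgebra.ι K (Finsupp.single i 1)
  else 0

/-- Matrices in `A` witnessing that `f⁽⁴⁾` is not an identity: the matrix of index `n` is
a polynomial in the matrices of smaller index. -/
noncomputable def genMat (K : Type) [Field K] (n i : ℕ) : Matrix (Fin 2) (Fin 2) (Einf K) :=
  !![if i < n then 0 else 1, if i = 1 then 1 else 0; 0, diagEntry K n i]

theorem genMat_mem (K : Type) [Field K] (n i : ℕ) : genMat K n i ∈ algA K (ℕ →₀ K) := by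
  refine ⟨?_, by simp [genMat]⟩
  have h : genMat K n i 0 0 = if i < n then 0 else 1 := by simp [genMat]
  rw [h]
  split_ifs
  · exact Submodule.zero_mem _
  · exact SetLike.one_mem_graded (CliffordAlgebra.evenOdd (0 : QuadraticForm K (ℕ →₀ K)))

theorem genMat_last (K : Type) [Field K] {n : ℕ} (hn : 2 ≤ n) :
    (genMat K n 0 - 1) ^ 2 = genMat K n n := by
  have h0 : 0 < n := by omega
  have h1 : n ≠ 1 := by omega
  ext i j
  fin_cases i <;> fin_cases j <;>
    simp [genMat, diagEntry, pow_two, Matrix.mul_apply, Fin.sum_univ_two, h0, h1]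

theorem prod_br_diagEntry (K : Type) [Field K] {n c : ℕ} (hc : n = 2 * c)
    (τ : ℕ → ℕ) (hτ : ∀ i < n, τ i < n) :
    (List.ofFn fun i : Fin c => br (diagEntry K n (τ (2 * i))) (diagEntry K n (τ (2 * i + 1)))).prod
      = (2 : K) ^ c • ExteriorAlgebra.ιMulti K n (fun i => Finsupp.single (τ i) (1 : K)) := by
  rw [ExteriorAlgebra.ιMulti_apply,
    ← prod_ofFn_pairs (fun i => ExteriorAlgebra.ι K (Finsupp.single (τ i) (1 : K))) c n hc]
  have h : ∀ i : Fin c, br (diagEntry K n (τ (2 * i))) (diagEntry K n (τ (2 * i + 1))) =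
      (2 : K) • (ExteriorAlgebra.ι K (Finsupp.single (τ (2 * i)) (1 : K)) *
        ExteriorAlgebra.ι K (Finsupp.single (τ (2 * i + 1)) (1 : K))) := fun i => by
    have hi := i.2
    rw [diagEntry, diagEntry, if_pos (hτ _ (by omega)), if_pos (hτ _ (by omega)),
      br_scalar_add_ι]
  simp only [h]
  exact prod_ofFn_smul _ _ _

theorem one_add_pow_mul_of_mul_eq_zero {R : Type} [Ring R] {a b : R} (h : a * b = 0) (k : ℕ) :
    (1 + a) ^ k * b = b := by
  induction k with
  | zero => simp
  | succ k ih => rw [pow_succ, mul_assoc, add_mul, h, one_mul, add_zero, ih]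

theorem commPow_genMat_last (K : Type) [Field K] {n : ℕ} (hn : 2 ≤ n) (k : ℕ) :
    commPow (br (br (genMat K n 1) (genMat K n 0)) (genMat K n n)) (genMat K n 0) k =
      !![0, -diagEntry K n 0 ^ (k + 1); 0, 0] := by
  have h0 : 0 < n := by omega
  have h1 : 1 < n := by omega
  have h2 : n ≠ 1 := by omega
  have h : br (br (genMat K n 1) (genMat K n 0)) (genMat K n n) =
      !![0, -diagEntry K n 0; 0, 0] := by
    simp only [genMat, br_upper]
    simp [br, h0, h1, h2, diagEntry]
  rw [h]
  simp only [genMat, h0, if_true, zero_ne_one, if_false]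
  rw [commPow_strictUpper, neg_mul, pow_succ']

theorem commPow_genMat_of_lt (K : Type) [Field K] {n j : ℕ} (hn : 2 ≤ n) (hj : j < n) (k : ℕ) :
    ∃ q r : Einf K,
      commPow (br (br (genMat K n 1) (genMat K n 0)) (genMat K n j)) (genMat K n 0) k =
        !![0, q; 0, r] := by
  have h0 : 0 < n := by omega
  have h1 : 1 < n := by omega
  simp only [genMat, br_upper, h0, h1, hj, if_true, show br (0 : Einf K) 0 = 0 by simp [br]]
  exact commPow_upper_zero _ _ _ _ k

/-- Evaluation of one summand of `f⁽⁴⁾` at the matrices `genMat`, with the missing basis vector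
multiplied on the left to make the outcome independent of the permutation up to sign. -/
theorem eval_summand (K : Type) [Field K] {n : ℕ} (hn : 2 ≤ n) (hne : Even n) (k : ℕ)
    (σ : Equiv.Perm (Fin (n + 1))) :
    (Equiv.Perm.sign σ : ℤ) • (ExteriorAlgebra.ι K (Finsupp.single n (1 : K)) *
      (commPow (br (br (genMat K n 1) (genMat K n 0)) (genMat K n (σ 0))) (genMat K n 0) k *
        (List.ofFn fun i : Fin (n / 2) =>
          br (genMat K n (σ ⟨2 * i.1 + 1, by have := i.2; omega⟩))
            (genMat K n (σ ⟨2 * i.1 + 2, by have := i.2; omega⟩))).prod) 0 1) =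
      if σ 0 = Fin.last n then
        -((2 : K) ^ (n / 2) • ExteriorAlgebra.ιMulti K (n + 1)
          (fun i : Fin (n + 1) => (Finsupp.single (i : ℕ) (1 : K) : ℕ →₀ K))) else 0 := by
  have hc : n = 2 * (n / 2) := by have := hne.two_dvd; omega
  let τ : ℕ → ℕ := fun i => if h : i + 1 < n + 1 then σ ⟨i + 1, h⟩ else 0
  have hprod : ∃ p q : Einf K, (List.ofFn fun i : Fin (n / 2) =>
      br (genMat K n (σ ⟨2 * i.1 + 1, by have := i.2; omega⟩))
        (genMat K n (σ ⟨2 * i.1 + 2, by have := i.2; omega⟩))).prod =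
      !![p, q; 0, (List.ofFn fun i : Fin (n / 2) =>
        br (diagEntry K n (τ (2 * i))) (diagEntry K n (τ (2 * i + 1)))).prod] := by
    have hτ1 : ∀ i : Fin (n / 2), (σ ⟨2 * i.1 + 1, by have := i.2; omega⟩ : ℕ) = τ (2 * i) :=
      fun i => by have := i.2; simp only [τ]; rw [dif_pos (by omega)]
    have hτ2 : ∀ i : Fin (n / 2), (σ ⟨2 * i.1 + 2, by have := i.2; omega⟩ : ℕ) = τ (2 * i + 1) :=
      fun i => by have := i.2; simp only [τ]; rw [dif_pos (by omega)]
    simp only [hτ1, hτ2, genMat, br_upper]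
    exact prod_ofFn_upper _ _ _ _
  obtain ⟨p, q, hpq⟩ := hprod
  rw [hpq]
  split_ifs with h
  · have hτ : ∀ i < n, τ i < n := fun i hi => by
      have h1 : σ ⟨i + 1, by omega⟩ ≠ Fin.last n := by
        rw [← h]; exact σ.injective.ne (by simp [Fin.ext_iff])
      have h2 := Fin.val_lt_last h1
      simp only [τ]
      rw [dif_pos (by omega)]
      exact h2
    have hτσ : (fun i : Fin n => (Finsupp.single (τ i) (1 : K) : ℕ →₀ K)) =
        fun i : Fin n => Finsupp.single (σ i.succ : ℕ) (1 : K) := by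
      ext1 i
      simp only [τ]
      rw [dif_pos (by omega)]
      rfl
    have hzero : ExteriorAlgebra.ι K (Finsupp.single 0 (1 : K)) * ExteriorAlgebra.ιMulti K n
        (fun i : Fin n => (Finsupp.single (σ i.succ : ℕ) (1 : K) : ℕ →₀ K)) = 0 := by
      obtain ⟨j, hj⟩ : ∃ j : Fin n, σ j.succ = 0 := by
        have : σ.symm 0 ≠ 0 := fun h' => by
          rw [Equiv.symm_apply_eq, h] at h'
          have := congrArg Fin.val h'
          simp at this
          omega
        obtain ⟨j, hj⟩ := Fin.exists_succ_eq.2 this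
        exact ⟨j, by rw [hj, Equiv.apply_symm_apply]⟩
      have hs := ExteriorAlgebra.ιMulti_succ_apply (R := K) (Fin.cons (Finsupp.single 0 (1 : K))
        (fun i : Fin n => (Finsupp.single (σ i.succ : ℕ) (1 : K) : ℕ →₀ K)))
      rw [AlternatingMap.map_eq_zero_of_eq _ _ (i := 0) (j := j.succ) (by simp [hj])
        (Fin.succ_ne_zero j).symm] at hs
      exact hs.symm
    have hperm := ExteriorAlgebra.ιMulti_succ_apply (R := K)
      ((fun i : Fin (n + 1) => (Finsupp.single (i : ℕ) (1 : K) : ℕ →₀ K)) ∘ σ)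
    rw [AlternatingMap.map_perm] at hperm
    have hpow : diagEntry K n 0 ^ (k + 1) * ExteriorAlgebra.ιMulti K n
        (fun i : Fin n => (Finsupp.single (σ i.succ : ℕ) (1 : K) : ℕ →₀ K)) = ExteriorAlgebra.ιMulti K n
        (fun i : Fin n => (Finsupp.single (σ i.succ : ℕ) (1 : K) : ℕ →₀ K)) := by
      rw [diagEntry, if_pos (by omega), if_pos rfl, map_one]
      exact one_add_pow_mul_of_mul_eq_zero hzero _
    rw [h, Fin.val_last, commPow_genMat_last K hn, prod_br_diagEntry K hc τ hτ, hτσ]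
    have hent : (!![0, -diagEntry K n 0 ^ (k + 1); 0, 0] * !![p, q; 0, (2 : K) ^ (n / 2) •
        ExteriorAlgebra.ιMulti K n
          (fun i : Fin n => (Finsupp.single (σ i.succ : ℕ) (1 : K) : ℕ →₀ K))]) 0 1 =
        -((2 : K) ^ (n / 2) • ExteriorAlgebra.ιMulti K n
          (fun i : Fin n => (Finsupp.single (σ i.succ : ℕ) (1 : K) : ℕ →₀ K))) := by
      simp [Matrix.mul_apply, Fin.sum_univ_two, hpow]
    have hlast : ExteriorAlgebra.ι K (Finsupp.single n (1 : K)) * ExteriorAlgebra.ιMulti K n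
        (fun i : Fin n => (Finsupp.single (σ i.succ : ℕ) (1 : K) : ℕ →₀ K)) =
        Equiv.Perm.sign σ • ExteriorAlgebra.ιMulti K (n + 1)
          (fun i : Fin (n + 1) => (Finsupp.single (i : ℕ) (1 : K) : ℕ →₀ K)) := by
      rw [hperm, Function.comp_apply, h]
      rfl
    rw [hent, mul_neg, mul_smul_comm, hlast, smul_neg, ← Units.smul_def, smul_comm, smul_smul,
      Int.units_mul_self, one_smul]
  · obtain ⟨q', r', hcp⟩ := commPow_genMat_of_lt K hn (Fin.val_lt_last h) k
    rw [hcp]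
    have hz : (List.ofFn fun i : Fin (n / 2) =>
        br (diagEntry K n (τ (2 * i))) (diagEntry K n (τ (2 * i + 1)))).prod = 0 := by
      have : σ.symm (Fin.last n) ≠ 0 := fun h' => h (by rw [← h', Equiv.apply_symm_apply])
      obtain ⟨j, hj⟩ := Fin.exists_succ_eq.2 this
      have hτj : diagEntry K n (τ j) = 0 := by
        have : τ j = n := by
          simp only [τ]
          rw [dif_pos (by omega)]
          change (σ j.succ : ℕ) = n
          rw [hj, Equiv.apply_symm_apply, Fin.val_last]
        rw [this, diagEntry, if_neg (lt_irrefl n)]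
      apply List.prod_eq_zero
      rw [List.mem_ofFn]
      refine ⟨⟨j / 2, by omega⟩, ?_⟩
      rcases Nat.even_or_odd' (j : ℕ) with ⟨l, hl | hl⟩
      · simp [br, show 2 * ((j : ℕ) / 2) = j by omega, hτj]
      · simp [br, show 2 * ((j : ℕ) / 2) + 1 = j by omega, hτj]
    simp [Matrix.mul_apply, Fin.sum_univ_two, hz]

/-- For even `n ≥ 2` and `m ≥ n + 3`, the polynomial
`f⁽⁴⁾_{m,n+1} = Σ_{σ ∈ S_{n+1}} sgn(σ)·[x₂,x₁,x_{σ(1)},x₁,…,x₁][x_{σ(2)},x_{σ(3)}]⋯[x_{σ(n)},x_{σ(n+1)}]`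
(with `m - n - 3` occurrences of `x₁` after `x_{σ(1)}`) is not a polynomial identity of
`F_n(A)`. -/
theorem f4_not_identity_of_relfree (K : Type) [Field K] [CharZero K]
    (n m : ℕ) (hn : 2 ≤ n) (hne : Even n) (hm : n + 3 ≤ m) :
    ¬ IsPI K (RelFree K (↥(algA K (ℕ →₀ K))) n)
        (∑ σ : Equiv.Perm (Fin (n + 1)), (Equiv.Perm.sign σ : ℤ) •
          (commPow (br (br (xv K 2) (xv K 1)) (xv K ((σ 0 : ℕ) + 1))) (xv K 1) (m - n - 3) *
            (List.ofFn fun i : Fin (n / 2) =>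
              br (xv K ((σ ⟨2 * i.1 + 1, by have := i.2; omega⟩ : ℕ) + 1))
                 (xv K ((σ ⟨2 * i.1 + 2, by have := i.2; omega⟩ : ℕ) + 1))).prod)) := by
  intro hf
  let w : ℕ → FreeAlgebra K (Fin n) := fun i =>
    if h : i - 1 < n then FreeAlgebra.ι K ⟨i - 1, h⟩
    else (FreeAlgebra.ι K ⟨0, by omega⟩ - 1) ^ 2
  let a : Fin n → algA K (ℕ →₀ K) := fun i => ⟨genMat K n i, genMat_mem K n i⟩
  have h0 := congrArg (algA K (ℕ →₀ K)).val (hf.eval_words_eq_zero w a)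
  rw [← AlgHom.comp_apply] at h0
  set Φ := (algA K (ℕ →₀ K)).val.comp
    (FreeAlgebra.lift K fun i => FreeAlgebra.lift K a (w i)) with hΦ
  have hgen : ∀ i ≤ n, Φ (xv K (i + 1)) = genMat K n i := fun i hi => by
    simp only [hΦ, AlgHom.comp_apply, xv, FreeAlgebra.lift_ι_apply, w, Nat.add_sub_cancel]
    rcases hi.lt_or_eq with h | rfl
    · rw [dif_pos h, FreeAlgebra.lift_ι_apply]
      rfl
    · rw [dif_neg (lt_irrefl i), map_pow, map_sub, map_one, FreeAlgebra.lift_ι_apply, map_pow,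
        map_sub, map_one]
      exact genMat_last K hn
  have hσ : ∀ (σ : Equiv.Perm (Fin (n + 1))) j, Φ (xv K ((σ j : ℕ) + 1)) = genMat K n (σ j) :=
    fun σ j => hgen _ (by omega)
  simp only [map_sum, map_zsmul, map_mul, map_commPow, map_br, map_list_prod, List.map_ofFn,
    Function.comp_def, hσ, map_zero,
    show Φ (xv K 1) = genMat K n 0 from hgen 0 (by omega),
    show Φ (xv K 2) = genMat K n 1 from hgen 1 (by omega)] at h0
  have h1 := congrArg (fun M : Matrix (Fin 2) (Fin 2) (Einf K) =>
    ExteriorAlgebra.ι K (Finsupp.single n (1 : K)) * M 0 1) h0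
  simp only [Matrix.sum_apply, Matrix.smul_apply, Finset.mul_sum, mul_smul_comm,
    eval_summand K hn hne, Matrix.zero_apply, mul_zero] at h1
  rw [← Finset.sum_filter, Finset.sum_const, smul_neg, neg_eq_zero, ← Nat.cast_smul_eq_nsmul K,
    smul_smul, smul_eq_zero] at h1
  refine h1.elim (fun h => ?_) (ιMulti_single_ne_zero K (n + 1))
  have hmem : Equiv.swap 0 (Fin.last n) ∈
      Finset.univ.filter fun σ : Equiv.Perm (Fin (n + 1)) => σ 0 = Fin.last n := by
    simp
  have hcard := Finset.card_ne_zero_of_mem hmem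
  exact mul_ne_zero (Nat.cast_ne_zero.2 hcard) (pow_ne_zero _ two_ne_zero) h
end

section
/- Let n ≥ 2 be an even integer. The relatively free algebra F_n(A) and the finite-dimensional algebra A^{(n)} satisfy the same polynomial identities: T(F_n(A)) = T(A^{(n)}). -/
open scoped TensorProduct

/-- The upper triangular matrix with diagonal entries `α`, `γ` and upper right entry `β`. -/
def triMat {Q : Type} [Ring Q] (α β γ : Q) : Matrix (Fin 2) (Fin 2) Q := !![α, β; 0, γ]

theorem triMat_mul {Q : Type} [Ring Q] (α β γ α' β' γ' : Q) :
    triMat α β γ * triMat α' β' γ' = triMat (α * α') (α * β' + β * γ') (γ * γ') := by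
  simp [triMat]

/-- Over an infinite field, polynomial identities survive extension of scalars to a
commutative algebra. -/
theorem IsPI.tensorProduct {K : Type} [Field K] [Infinite K] {X : Type} {R : Type} [Ring R]
    [Algebra K R] {f : FreeAlgebra K X} (hf : IsPI K R f)
    (S : Type) [CommRing S] [Algebra K S] : IsPI K (S ⊗[K] R) f := by
  intro φ
  obtain ⟨κ, ⟨b⟩⟩ : ∃ κ : Type, Nonempty (Module.Basis κ K R) :=
    ⟨_, ⟨Module.Free.chooseBasis K R⟩⟩
  let c : X → κ →₀ S := fun x =>
    (Algebra.TensorProduct.basis S b).repr (φ (FreeAlgebra.ι K x))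
  have hc : ∀ x, φ (FreeAlgebra.ι K x) = ∑ k ∈ (c x).support, c x k ⊗ₜ[K] b k := by
    intro x
    have h := (Algebra.TensorProduct.basis S b).linearCombination_repr (φ (FreeAlgebra.ι K x))
    rw [← h, Finsupp.linearCombination_apply, Finsupp.sum]
    refine Finset.sum_congr rfl fun k _ => ?_
    simp [c, TensorProduct.smul_tmul']
  let ξ : FreeAlgebra K X →ₐ[K] MvPolynomial (X × κ) K ⊗[K] R := FreeAlgebra.lift K fun x =>
    ∑ k ∈ (c x).support, (MvPolynomial.X (x, k) : MvPolynomial (X × κ) K) ⊗ₜ[K] b k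
  have hξ : ξ f = 0 := by
    apply (Algebra.TensorProduct.basis (MvPolynomial (X × κ) K) b).repr.injective
    rw [map_zero]
    ext1 k
    rw [Finsupp.zero_apply]
    apply MvPolynomial.funext
    intro s
    have hcomm : ∀ p r, Commute ((Algebra.ofId K R).comp
        (MvPolynomial.aeval s : MvPolynomial (X × κ) K →ₐ[K] K) p) (AlgHom.id K R r) :=
      fun p r => Algebra.commutes _ r
    let ev : MvPolynomial (X × κ) K ⊗[K] R →ₐ[K] R := Algebra.TensorProduct.lift
      ((Algebra.ofId K R).comp (MvPolynomial.aeval s)) (AlgHom.id K R) hcomm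
    have hev : ∀ z, MvPolynomial.eval s ((Algebra.TensorProduct.basis (MvPolynomial (X × κ) K) b).repr z k)
        = b.repr (ev z) k := by
      intro z
      induction z with
      | zero => simp
      | add x y hx hy => simp [hx, hy]
      | tmul p r =>
        simp [ev, Algebra.ofId_apply, ← Algebra.smul_def, MvPolynomial.aeval_eq_eval,
          MvPolynomial.algebraMap_eq]
    rw [hev, show ev (ξ f) = 0 from hf (ev.comp ξ)]
    simp
  let sp : MvPolynomial (X × κ) K ⊗[K] R →ₐ[K] S ⊗[K] R := Algebra.TensorProduct.map
    (MvPolynomial.aeval fun xk => c xk.1 xk.2) (AlgHom.id K R)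
  have h : φ = sp.comp ξ := by
    apply FreeAlgebra.hom_ext
    funext x
    simp [ξ, sp, hc x]
  rw [h, AlgHom.comp_apply, hξ, map_zero]

theorem IsPI.map_eq_zero {K : Type} [Field K] {X : Type} {R M : Type} [Ring R]
    [Algebra K R] [Ring M] [Algebra K M] {f : FreeAlgebra K X} (hf : IsPI K R f)
    (H : R →ₐ[K] M) (φ : FreeAlgebra K X →ₐ[K] M)
    (hφ : ∀ x, φ (FreeAlgebra.ι K x) ∈ H.range) : φ f = 0 := by
  choose r hr using hφ
  have h : φ = H.comp (FreeAlgebra.lift K r) := by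
    apply FreeAlgebra.hom_ext
    funext x
    simpa using (hr x).symm
  rw [h, AlgHom.comp_apply, hf, map_zero]

/-- The homomorphism `S ⊗ R → M₂(Q)` given by a homomorphism `R → M₂(Q)` and a homomorphism
from `S` to the centre of `Q`, acting by scalar matrices. -/
def scalarExt {K : Type} [Field K] {S R Q : Type} [CommRing S] [Algebra K S] [Ring R]
    [Algebra K R] [Ring Q] [Algebra K Q] (σ : S →ₐ[K] Q) (hσ : ∀ s q, Commute (σ s) q)
    (ρ : R →ₐ[K] Matrix (Fin 2) (Fin 2) Q) : S ⊗[K] R →ₐ[K] Matrix (Fin 2) (Fin 2) Q :=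
  Algebra.TensorProduct.lift
    ((Matrix.diagonalAlgHom K).comp ((Pi.constAlgHom K (Fin 2) Q).comp σ)) ρ
    fun s r => by
      rw [show ((Matrix.diagonalAlgHom K).comp ((Pi.constAlgHom K (Fin 2) Q).comp σ)) s =
        Matrix.scalar (Fin 2) (σ s) from rfl]
      exact Matrix.scalar_commute (σ s) (hσ s) (ρ r)

theorem scalarExt_tmul {K : Type} [Field K] {S R Q : Type} [CommRing S] [Algebra K S] [Ring R]
    [Algebra K R] [Ring Q] [Algebra K Q] (σ : S →ₐ[K] Q) (hσ : ∀ s q, Commute (σ s) q)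
    (ρ : R →ₐ[K] Matrix (Fin 2) (Fin 2) Q) (s : S) (r : R) :
    scalarExt σ hσ ρ (s ⊗ₜ r) = triMat (σ s) 0 (σ s) * ρ r := by
  rw [scalarExt, Algebra.TensorProduct.lift_tmul]
  congr 1
  ext i j
  fin_cases i <;> fin_cases j <;> simp [triMat]

theorem IsPI.lift_triMat_eq_zero {K : Type} [Field K] [Infinite K] {X : Type}
    {S R Q : Type} [CommRing S] [Algebra K S] [Ring R]
    [Algebra K R] [Ring Q] [Algebra K Q] {f : FreeAlgebra K X} (hf : IsPI K R f)
    (σ : S →ₐ[K] Q) (hσ : ∀ s q, Commute (σ s) q)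
    (ρ : R →ₐ[K] Matrix (Fin 2) (Fin 2) Q)
    (h₁ : triMat 1 0 0 ∈ ρ.range) (h₂ : triMat 0 1 0 ∈ ρ.range)
    (h₃ : ∀ q, triMat 0 0 q ∈ (scalarExt σ hσ ρ).range)
    (α : X → S) (β γ : X → Q) :
    FreeAlgebra.lift K (fun x => triMat (σ (α x)) (β x) (γ x)) f = 0 := by
  refine (hf.tensorProduct S).map_eq_zero (scalarExt σ hσ ρ) _ fun x => ?_
  rw [FreeAlgebra.lift_ι_apply]
  have hρ : ∀ m ∈ ρ.range, ∀ s, triMat (σ s) 0 (σ s) * m ∈ (scalarExt σ hσ ρ).range := by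
    rintro _ ⟨r, rfl⟩ s
    exact ⟨s ⊗ₜ r, scalarExt_tmul σ hσ ρ s r⟩
  have e : triMat (σ (α x)) (β x) (γ x) = triMat (σ (α x)) 0 (σ (α x)) * triMat 1 0 0
      + (triMat (σ 1) 0 (σ 1) * triMat 0 1 0) * triMat 0 0 (β x) + triMat 0 0 (γ x) := by
    simp [triMat_mul]
    simp [triMat]
  rw [e]
  exact add_mem (add_mem (hρ _ h₁ _) (mul_mem (hρ _ h₂ _) (h₃ _))) (h₃ _)

/-- Evaluation at upper triangular matrices with central upper left entries. The upper right
entry depends linearly on the upper right entries of the arguments. -/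
theorem exists_lift_triMat_eq {K : Type} [Field K] {X : Type} {Q : Type} [Ring Q] [Algebra K Q]
    (α γ : X → Q) (f : FreeAlgebra K X) :
    ∃ w : X →₀ Q, ∀ (E : Type) [Ring E] [Algebra K E] (h : Q →ₐ[K] E) (β : X → E),
      (∀ x e, Commute (h (α x)) e) →
      (∀ e, Commute (h (FreeAlgebra.lift K α f)) e) ∧
      FreeAlgebra.lift K (fun x => triMat (h (α x)) (β x) (h (γ x))) f =
        triMat (h (FreeAlgebra.lift K α f)) (w.sum fun x q => β x * h q)
          (h (FreeAlgebra.lift K γ f)) := by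
  classical
  induction f using FreeAlgebra.induction with
  | grade0 r =>
    refine ⟨0, fun E _ _ h β hα => ⟨fun e => ?_, ?_⟩⟩
    · rw [AlgHom.commutes, AlgHom.commutes]
      exact Algebra.commutes r e
    · ext i j
      fin_cases i <;> fin_cases j <;> simp [triMat, Matrix.algebraMap_matrix_apply]
  | grade1 x =>
    refine ⟨Finsupp.single x 1, fun E _ _ h β hα => ⟨fun e => ?_, ?_⟩⟩
    · simpa using hα x e
    · simp
  | add a b iha ihb =>
    obtain ⟨u, hu⟩ := iha
    obtain ⟨v, hv⟩ := ihb
    refine ⟨u + v, fun E _ _ h β hα => ⟨fun e => ?_, ?_⟩⟩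
    · simpa using ((hu E h β hα).1 e).add_left ((hv E h β hα).1 e)
    · rw [map_add, (hu E h β hα).2, (hv E h β hα).2,
        Finsupp.sum_add_index' (by simp) (by simp [mul_add])]
      simp [triMat]
  | mul a b iha ihb =>
    obtain ⟨u, hu⟩ := iha
    obtain ⟨v, hv⟩ := ihb
    refine ⟨v.mapRange (FreeAlgebra.lift K α a * ·) (by simp) +
      u.mapRange (· * FreeAlgebra.lift K γ b) (by simp), fun E _ _ h β hα => ⟨fun e => ?_, ?_⟩⟩
    · simpa using ((hu E h β hα).1 e).mul_left ((hv E h β hα).1 e)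
    · rw [map_mul, (hu E h β hα).2, (hv E h β hα).2,
        Finsupp.sum_add_index' (by simp) (by simp [mul_add]), triMat_mul,
        Finsupp.sum_mapRange_index (by simp), Finsupp.sum_mapRange_index (by simp)]
      simp only [map_mul, Finsupp.mul_sum, Finsupp.sum_mul, ← mul_assoc]
      congr 3
      ext x q
      rw [((hu E h β hα).1 (β x)).eq]

theorem lift_triMat_eq_zero_of_algHom {K : Type} [Field K] {X : Type} {Q E : Type} [Ring Q]
    [Algebra K Q] [Ring E] [Algebra K E] (h : Q →ₐ[K] E) {α γ : X → Q} {f : FreeAlgebra K X}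
    (hQ : ∀ x q, Commute (α x) q) (hE : ∀ x e, Commute (h (α x)) e)
    (hf : ∀ β : X → Q, FreeAlgebra.lift K (fun x => triMat (α x) (β x) (γ x)) f = 0)
    (β : X → E) :
    FreeAlgebra.lift K (fun x => triMat (h (α x)) (β x) (h (γ x))) f = 0 := by
  classical
  obtain ⟨w, hw⟩ := exists_lift_triMat_eq (K := K) α γ f
  have key : ∀ δ : X → Q, triMat (FreeAlgebra.lift K α f) (w.sum fun x q => δ x * q)
      (FreeAlgebra.lift K γ f) = 0 := by
    intro δ
    have := (hw Q (AlgHom.id K Q) δ (by simpa using hQ)).2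
    simpa [hf δ] using this.symm
  have hα : FreeAlgebra.lift K α f = 0 := congrFun₂ (key 0) 0 0
  have hγ : FreeAlgebra.lift K γ f = 0 := congrFun₂ (key 0) 1 1
  have hw0 : w = 0 := by
    ext x
    have := congrFun₂ (key (Pi.single x 1)) 0 1
    have e : (w.sum fun y q => (Pi.single x 1 : X → Q) y * q) = w x := by
      rw [Finsupp.sum, Finset.sum_eq_single x]
      · simp
      · intro y _ hy
        simp [hy]
      · intro hx
        simpa using hx
    rw [e] at this
    exact this
  rw [(hw E h β hE).2, hα, hγ, hw0]
  ext i j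
  fin_cases i <;> fin_cases j <;> simp [triMat]

section ExteriorAlgebra

variable {K V : Type} [Field K] [AddCommGroup V] [Module K V]

theorem ι_mul_ι_swap (u v : V) : ExteriorAlgebra.ι K u * ExteriorAlgebra.ι K v =
    -(ExteriorAlgebra.ι K v * ExteriorAlgebra.ι K u) :=
  eq_neg_of_add_eq_zero_left (ExteriorAlgebra.ι_add_mul_swap u v)

theorem commute_ι_mul_ι (u v : V) (y : ExteriorAlgebra K V) :
    Commute (ExteriorAlgebra.ι K u * ExteriorAlgebra.ι K v) y := by
  induction y using ExteriorAlgebra.induction with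
  | algebraMap r => exact Algebra.commute_algebraMap_right r _
  | ι w =>
    rw [Commute, SemiconjBy, mul_assoc, ι_mul_ι_swap v w, mul_neg, ← mul_assoc, ι_mul_ι_swap u w,
      neg_mul, neg_neg, mul_assoc]
  | mul a b ha hb => exact ha.mul_right hb
  | add a b ha hb => exact ha.add_right hb

theorem commute_of_mem_evenPart {x : ExteriorAlgebra K V} (hx : x ∈ evenPart K V)
    (y : ExteriorAlgebra K V) : Commute x y := by
  refine CliffordAlgebra.even_induction (0 : QuadraticForm K V)
    (motive := fun x _ => Commute x y) ?_ ?_ ?_ x hx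
  · exact fun r => Algebra.commute_algebraMap_left r y
  · exact fun a b _ _ ha hb => ha.add_left hb
  · exact fun u v a _ ha => (commute_ι_mul_ι u v y).mul_left ha

theorem mul_swap_of_forall_ι {x y : ExteriorAlgebra K V} (hx : x ∈ oddPart K V)
    (hy : ∀ v, ExteriorAlgebra.ι K v * y = -(y * ExteriorAlgebra.ι K v)) :
    x * y = -(y * x) := by
  refine CliffordAlgebra.odd_induction (0 : QuadraticForm K V)
    (P := fun x _ => x * y = -(y * x)) hy ?_ ?_ x hx
  · intro a b _ _ ha hb
    rw [add_mul, mul_add, ha, hb, neg_add]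
  · intro u v a _ ha
    rw [mul_assoc, ha, mul_neg, ← mul_assoc, ← mul_assoc]
    congr 2
    exact (commute_ι_mul_ι u v y).eq

theorem mul_self_of_mem_oddPart [CharZero K] {x : ExteriorAlgebra K V} (hx : x ∈ oddPart K V) :
    x * x = 0 := by
  have h : x * x = -(x * x) := mul_swap_of_forall_ι hx fun v =>
    neg_eq_iff_eq_neg.mp (mul_swap_of_forall_ι hx (ι_mul_ι_swap · v)).symm
  have h2 : (2 : K) • (x * x) = 0 := by
    rw [two_smul]
    nth_rewrite 1 [h]
    exact neg_add_cancel _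
  exact (smul_eq_zero.mp h2).resolve_left two_ne_zero

theorem exists_evenPart_add_oddPart (x : ExteriorAlgebra K V) :
    ∃ y ∈ evenPart K V, ∃ z ∈ oddPart K V, y + z = x :=
  Submodule.mem_sup.mp ((CliffordAlgebra.evenOdd_isCompl (0 : QuadraticForm K V)).sup_eq_top ▸
    Submodule.mem_top (R := K) (x := x))

theorem mem_center_of_mem_evenPart {x : ExteriorAlgebra K V} (hx : x ∈ evenPart K V) :
    x ∈ Subalgebra.center K (ExteriorAlgebra K V) :=
  Subalgebra.mem_center_iff.mpr fun y => (commute_of_mem_evenPart hx y).eq.symm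

theorem triMat_mem_algA {α : ExteriorAlgebra K V} (hα : α ∈ evenPart K V)
    (β γ : ExteriorAlgebra K V) : triMat α β γ ∈ algA K V :=
  ⟨hα, rfl⟩

theorem eq_triMat_of_mem_algA {M : Matrix (Fin 2) (Fin 2) (ExteriorAlgebra K V)}
    (hM : M ∈ algA K V) : M = triMat (M 0 0) (M 0 1) (M 1 1) := by
  ext i j
  fin_cases i <;> fin_cases j <;> simp [triMat, hM.2]

variable (K V) in
/-- The projection of `A` to the lower right entry. -/
def algALowerRight : algA K V →ₐ[K] ExteriorAlgebra K V where
  toFun M := M.1 1 1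
  map_one' := rfl
  map_zero' := rfl
  map_add' _ _ := rfl
  map_mul' M N := by simp [Matrix.mul_apply, Fin.sum_univ_two, M.2.2]
  commutes' r := by simp [Matrix.algebraMap_matrix_apply]

end ExteriorAlgebra

theorem RelFree.mk_eq_zero {K : Type} [Field K] {R : Type} [Ring R] [Algebra K R] {n : ℕ}
    {g : FreeAlgebra K (Fin n)} (hg : IsPI K R g) :
    (RingQuot.mkAlgHom K _ g : RelFree K R n) = 0 := by
  rw [← map_zero (RingQuot.mkAlgHom K fun f g : FreeAlgebra K (Fin n) => IsPI K R (f - g))]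
  exact RingQuot.mkAlgHom_rel K (by simpa using hg)

/-- The homomorphism from the relatively free algebra induced by an algebra homomorphism to `R`. -/
def RelFree.lift {K : Type} [Field K] {R : Type} [Ring R] [Algebra K R] {n : ℕ}
    (φ : FreeAlgebra K (Fin n) →ₐ[K] R) : RelFree K R n →ₐ[K] R :=
  RingQuot.liftAlgHom K ⟨φ, fun f g h => sub_eq_zero.mp (by rw [← map_sub]; exact h φ)⟩

theorem RelFree.lift_mk {K : Type} [Field K] {R : Type} [Ring R] [Algebra K R] {n : ℕ}
    (φ : FreeAlgebra K (Fin n) →ₐ[K] R) (g : FreeAlgebra K (Fin n)) :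
    RelFree.lift φ (RingQuot.mkAlgHom K _ g) = φ g :=
  RingQuot.liftAlgHom_mkAlgHom_apply K _ _ _

/-- An identity of `R` in the algebras generated by `n` elements is an identity of `F_n(R)`. -/
theorem isPI_relFree {K : Type} [Field K] {R : Type} [Ring R] [Algebra K R] {n : ℕ} {X : Type}
    {f : FreeAlgebra K X}
    (hf : ∀ (g : X → FreeAlgebra K (Fin n)) (φ : FreeAlgebra K (Fin n) →ₐ[K] R),
      FreeAlgebra.lift K (fun x => φ (g x)) f = 0) : IsPI K (RelFree K R n) f := by
  intro ψ
  choose g hg using fun x => RingQuot.mkAlgHom_surjective K _ (ψ (FreeAlgebra.ι K x))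
  have h : ψ = (RingQuot.mkAlgHom K _).comp (FreeAlgebra.lift K g) := by
    apply FreeAlgebra.hom_ext
    funext x
    simpa using (hg x).symm
  rw [h, AlgHom.comp_apply]
  refine RelFree.mk_eq_zero fun φ => ?_
  rw [← hf g φ, ← AlgHom.comp_apply]
  congr 1
  apply FreeAlgebra.hom_ext
  funext x
  simp

theorem isPI_relFree_algA {K : Type} [Field K] [CharZero K] {V X : Type} [AddCommGroup V]
    [Module K V] {n : ℕ} {f : FreeAlgebra K X} (hf : IsPI K (algA K (Fin n → K)) f) :
    IsPI K (RelFree K (algA K V) n) f := by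
  refine isPI_relFree fun g φ => ?_
  choose c hc d hd hcd using fun i : Fin n =>
    exists_evenPart_add_oddPart (algALowerRight K V (φ (FreeAlgebra.ι K i)))
  let S := Subalgebra.center K (ExteriorAlgebra K V)
  have hL : ∀ v, Fintype.linearCombination K d v * Fintype.linearCombination K d v = 0 := by
    intro v
    apply mul_self_of_mem_oddPart
    rw [Fintype.linearCombination_apply]
    exact Submodule.sum_mem _ fun i _ => Submodule.smul_mem _ _ (hd i)
  have hS : ∀ (s : S) (e : ExteriorAlgebra K V), Commute (S.val s) e := fun s e =>
    (Subalgebra.mem_center_iff.mp s.2 e).symm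
  let η : Efin K n →ₐ[K] ExteriorAlgebra K V :=
    ExteriorAlgebra.lift K ⟨Fintype.linearCombination K d, hL⟩
  let h : S ⊗[K] Efin K n →ₐ[K] ExteriorAlgebra K V :=
    Algebra.TensorProduct.lift S.val η fun s q => hS s _
  let σ : S →ₐ[K] S ⊗[K] Efin K n := Algebra.TensorProduct.includeLeft
  have hσ : ∀ s q, Commute (σ s) q := fun s q => Algebra.commutes s q
  have hσh : ∀ s : S, h (σ s) = s := fun s => by simp [h, σ]
  let ρ : algA K (Fin n → K) →ₐ[K] Matrix (Fin 2) (Fin 2) (S ⊗[K] Efin K n) :=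
    (Algebra.TensorProduct.includeRight.mapMatrix).comp (algA K (Fin n → K)).val
  have hρ : ∀ α (hα : α ∈ evenPart K (Fin n → K)) β γ,
      ρ ⟨triMat α β γ, triMat_mem_algA hα β γ⟩ = triMat (1 ⊗ₜ α) (1 ⊗ₜ β) (1 ⊗ₜ γ) := by
    intro α hα β γ
    ext i j
    fin_cases i <;> fin_cases j <;> simp [ρ, triMat]
  let cl : Fin n → S ⊗[K] Efin K n := fun i =>
    σ ⟨c i, mem_center_of_mem_evenPart (hc i)⟩ + 1 ⊗ₜ ExteriorAlgebra.ι K (Pi.single i 1)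
  have hcl : (algALowerRight K V).comp φ = h.comp (FreeAlgebra.lift K cl) := by
    apply FreeAlgebra.hom_ext
    funext i
    simp only [Function.comp_apply, AlgHom.comp_apply, FreeAlgebra.lift_ι_apply, cl, map_add, hσh,
      ← hcd i]
    simp [h, η]
  let α : X → S := fun x => ⟨(φ (g x)).1 0 0, mem_center_of_mem_evenPart (φ (g x)).2.1⟩
  let γ : X → S ⊗[K] Efin K n := fun x => FreeAlgebra.lift K cl (g x)
  have hφ : ∀ x, (φ (g x)).1 = triMat (h (σ (α x))) ((φ (g x)).1 0 1) (h (γ x)) := by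
    intro x
    rw [hσh, ← AlgHom.comp_apply h, ← hcl]
    exact eq_triMat_of_mem_algA (φ (g x)).2
  apply Subtype.ext
  have e : (algA K V).val.comp (FreeAlgebra.lift K (fun x => φ (g x))) =
      FreeAlgebra.lift K fun x => triMat (h (σ (α x))) ((φ (g x)).1 0 1) (h (γ x)) := by
    apply FreeAlgebra.hom_ext
    funext x
    simp [← hφ]
  refine (DFunLike.congr_fun e f).trans
    (lift_triMat_eq_zero_of_algHom h (fun x q => hσ _ _) (fun x e => ?_) (fun β => ?_) _)
  · rw [hσh]
    exact hS (α x) e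
  refine hf.lift_triMat_eq_zero σ hσ ρ ?_ ?_ ?_ α β γ
  · exact ⟨_, (hρ 1 (SetLike.one_mem_graded _) 0 0).trans
      (by simp [Algebra.TensorProduct.one_def])⟩
  · exact ⟨_, (hρ 0 (zero_mem _) 1 0).trans (by simp [Algebra.TensorProduct.one_def])⟩
  · intro q
    induction q with
    | zero =>
      rw [show triMat (0 : S ⊗[K] Efin K n) 0 0 = 0 by
        ext i j; fin_cases i <;> fin_cases j <;> simp [triMat]]
      exact zero_mem _
    | add p q hp hq =>
      rw [show triMat 0 0 (p + q) = triMat 0 0 p + triMat 0 0 q by simp [triMat]]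
      exact add_mem hp hq
    | tmul s e =>
      refine ⟨s ⊗ₜ ⟨triMat 0 0 e, triMat_mem_algA (zero_mem _) 0 e⟩, ?_⟩
      refine (scalarExt_tmul σ hσ ρ _ _).trans ?_
      rw [hρ _ (zero_mem _), triMat_mul]
      simp [σ]

theorem isPI_algA_of_relFree {K : Type} [Field K] [CharZero K] {X : Type}
    {n : ℕ} (hn : 2 ≤ n) {f : FreeAlgebra K X}
    (hf : IsPI K (RelFree K (algA K (ℕ →₀ K)) n) f) : IsPI K (algA K (Fin n → K)) f := by
  let p : ExteriorAlgebra K (ℕ →₀ K) →ₐ[K] Efin K n := ExteriorAlgebra.map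
    ((LinearMap.funLeft K K (Fin.val : Fin n → ℕ)).comp Finsupp.lcoeFun)
  have hp : ∀ i : Fin n, p (ExteriorAlgebra.ι K (Finsupp.single i.1 1)) =
      ExteriorAlgebra.ι K (Pi.single i 1) := by
    intro i
    rw [ExteriorAlgebra.map_apply_ι]
    congr 1
    ext j
    simp [LinearMap.funLeft_apply, Finsupp.single_apply, Pi.single_apply, Fin.ext_iff, eq_comm]
  have heven : ∀ i : ℕ, (if i = 0 then 1 else 0) ∈ evenPart K (ℕ →₀ K) := by
    intro i
    split_ifs
    exacts [SetLike.one_mem_graded _, zero_mem _]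
  let φ : FreeAlgebra K (Fin n) →ₐ[K] algA K (ℕ →₀ K) := FreeAlgebra.lift K fun i =>
    ⟨triMat (if i.1 = 0 then 1 else 0) (if i.1 = 1 then 1 else 0)
      (ExteriorAlgebra.ι K (Finsupp.single i.1 1)), triMat_mem_algA (heven i) _ _⟩
  let ρ : RelFree K (algA K (ℕ →₀ K)) n →ₐ[K] Matrix (Fin 2) (Fin 2) (Efin K n) :=
    (p.mapMatrix.comp (algA K (ℕ →₀ K)).val).comp (RelFree.lift φ)
  have hρ : ∀ i : Fin n, triMat (if i.1 = 0 then 1 else 0) (if i.1 = 1 then 1 else 0)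
      (ExteriorAlgebra.ι K (Pi.single i 1)) ∈ ρ.range := by
    intro i
    refine ⟨RingQuot.mkAlgHom K _ (FreeAlgebra.ι K i), ?_⟩
    change p.mapMatrix (RelFree.lift φ (RingQuot.mkAlgHom K _ (FreeAlgebra.ι K i))).1 = _
    rw [RelFree.lift_mk, FreeAlgebra.lift_ι_apply, ← hp]
    ext j k
    fin_cases j <;> fin_cases k <;> simp [triMat, apply_ite p]
  have h₁ : triMat 1 0 0 ∈ ρ.range := by
    have := mul_mem (hρ ⟨0, by omega⟩) (hρ ⟨0, by omega⟩)
    simpa [triMat_mul, ExteriorAlgebra.ι_sq_zero] using this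
  have h₂ : triMat 0 1 0 ∈ ρ.range := by
    have := mul_mem h₁ (hρ ⟨1, by omega⟩)
    simpa [triMat_mul] using this
  have h₂₂ : triMat 0 0 1 ∈ ρ.range := by
    have := sub_mem (one_mem _) h₁
    rwa [show (1 : Matrix (Fin 2) (Fin 2) (Efin K n)) - triMat 1 0 0 = triMat 0 0 1 by
      ext i j; fin_cases i <;> fin_cases j <;> simp [triMat]] at this
  have h₃ : ∀ q, triMat 0 0 q ∈ ρ.range := by
    have hadd : ∀ a b : Efin K n, triMat 0 0 a ∈ ρ.range → triMat 0 0 b ∈ ρ.range →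
        triMat 0 0 (a + b) ∈ ρ.range := by
      intro a b ha hb
      rw [show triMat 0 0 (a + b) = triMat 0 0 a + triMat 0 0 b by simp [triMat]]
      exact add_mem ha hb
    have hsmul : ∀ (r : K) (a : Efin K n), triMat 0 0 a ∈ ρ.range →
        triMat 0 0 (r • a) ∈ ρ.range := by
      intro r a ha
      rw [show triMat 0 0 (r • a) = r • triMat 0 0 a by simp [triMat]]
      exact Subalgebra.smul_mem _ ha r
    intro q
    induction q using ExteriorAlgebra.induction with
    | algebraMap r =>
      rw [Algebra.algebraMap_eq_smul_one]
      exact hsmul r 1 h₂₂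
    | ι v =>
      rw [pi_eq_sum_univ' v, map_sum]
      refine Finset.sum_induction _ (fun q => triMat 0 0 q ∈ ρ.range) hadd ?_ fun i _ => ?_
      · simpa using hsmul 0 1 h₂₂
      · rw [map_smul]
        refine hsmul _ _ ?_
        have := mul_mem h₂₂ (hρ i)
        simpa [triMat_mul, ← Pi.single_apply] using this
    | mul a b ha hb => simpa [triMat_mul] using mul_mem ha hb
    | add a b ha hb => exact hadd a b ha hb
  let S := Subalgebra.center K (Efin K n)
  have hS : ∀ (s : S) (e : Efin K n), Commute (S.val s) e := fun s e =>
    (Subalgebra.mem_center_iff.mp s.2 e).symm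
  intro ψ
  let α : X → S := fun x => ⟨(ψ (FreeAlgebra.ι K x)).1 0 0,
    mem_center_of_mem_evenPart (ψ (FreeAlgebra.ι K x)).2.1⟩
  have e : (algA K (Fin n → K)).val.comp ψ = FreeAlgebra.lift K fun x =>
      triMat (S.val (α x)) ((ψ (FreeAlgebra.ι K x)).1 0 1) ((ψ (FreeAlgebra.ι K x)).1 1 1) := by
    apply FreeAlgebra.hom_ext
    funext x
    rw [Function.comp_apply, Function.comp_apply, FreeAlgebra.lift_ι_apply]
    exact eq_triMat_of_mem_algA (ψ (FreeAlgebra.ι K x)).2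
  apply Subtype.ext
  refine (DFunLike.congr_fun e f).trans
    (hf.lift_triMat_eq_zero S.val hS ρ h₁ h₂ (fun q => ?_) α _ _)
  obtain ⟨r, hr⟩ := h₃ q
  refine ⟨1 ⊗ₜ r, (scalarExt_tmul S.val hS ρ 1 r).trans ?_⟩
  rw [show ρ r = triMat 0 0 q from hr, triMat_mul]
  simp

/-- For even `n ≥ 2`, the relatively free algebra `F_n(A)` and the
finite-dimensional algebra `A⁽ⁿ⁾` satisfy the same polynomial identities. -/
theorem tideal_relfree_eq_tideal_algA_fin (K : Type) [Field K] [CharZero K]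
    (n : ℕ) (hn : 2 ≤ n) (hne : Even n) :
    TId K (RelFree K (↥(algA K (ℕ →₀ K))) n) = TId K (↥(algA K (Fin n → K))) := by
  ext f
  exact ⟨isPI_algA_of_relFree hn, isPI_relFree_algA⟩
end
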